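/- arXiv:2311.14609 — 2 statements merged into one kernel-verified Lean document; each statement's English description precedes it below -/
import Mathlib

section
/- Covering number bound for interaction-model networks (Lemma 8): let α ≥ 1, β > 0, A, B, C ≥ 1, and let σ : ℝ → ℝ be k-times differentiable with all derivatives up to order k bounded on ℝ. Let F be the set of all functions f_w(x) = Σ_{I ⊆ {1,…,d}: |I| = d*} f_{w_I}(x_I), where each f_{w_I} is a network with input dimension d* and weight vector w_I satisfying Σ_{j=1}^{K_n} |(w_I)^{(L)}_{1,1,j}| ≤ C, |(w_I)^{(l)}_{k,i,j}| ≤ B for all k ∈ {1,…,K_n}, i, j ∈ {1,…,r}, l ∈ {1,…,L−1}, and |(w_I)^{(0)}_{k,i,j}| ≤ A for all k ∈ {1,…,K_n}, i ∈ {1,…,r}, j ∈ {1,…,d}. Then there exist constants c₁₉, c₂₀, c₂₁ such that for any 1 ≤ p < ∞, 0 < ε < β and x_1^n ∈ ([−α,α]^d)^n: N_p(ε, {T_β f : f ∈ F}, x_1^n) ≤ (c₁₉·β^p/ε^p)^{c₂₀·α^{d*}·A^{d*}·B^{(L−1)·d*}·(C/ε)^{d*/k} + c₂₁}. -/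
open scoped BigOperators

/-- Index type for the weights of a linear combination of `K` fully connected networks
with `L` layers, `r` neurons per layer and input dimension `d`:
`out k` is the output weight `w^{(L)}_{1,1,k}` (paper index `k+1`),
`inner l k i j` is the weight `w^{(l+1)}_{k+1,i+1,j}` (layers `1,…,L-1`, `j = 0` the bias),
`input k i j` is the weight `w^{(0)}_{k+1,i+1,j}` (`j = 0` the bias). -/
inductive NNIdx (K L r d : ℕ) : Type where
  | out (k : Fin K)
  | inner (l : Fin (L - 1)) (k : Fin K) (i : Fin r) (j : Fin (r + 1))
  | input (k : Fin K) (i : Fin r) (j : Fin (d + 1))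
  deriving DecidableEq, Fintype

/-- `nOut σ K L r d w k l i x` is the output `f^{(l)}_{k+1,i+1}(x)` of neuron `i+1`
in layer `l` of the `k+1`-st fully connected network with weights `w` and activation `σ`. -/
noncomputable def nOut (σ : ℝ → ℝ) (K L r d : ℕ) (w : NNIdx K L r d → ℝ) (k : Fin K) :
    ℕ → Fin r → (Fin d → ℝ) → ℝ
  | 0, _, _ => 0
  | 1, i, x => σ ((∑ j : Fin d, w (NNIdx.input k i j.succ) * x j) + w (NNIdx.input k i 0))
  | l + 2, i, x =>
    if h : l < L - 1 then
      σ ((∑ j : Fin r, w (NNIdx.inner ⟨l, h⟩ k i j.succ) * nOut σ K L r d w k (l + 1) j x)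
        + w (NNIdx.inner ⟨l, h⟩ k i 0))
    else 0

/-- The network `f_w(x) = ∑_{k=1}^{K} w^{(L)}_{1,1,k}·f^{(L)}_{k,1}(x)`. -/
noncomputable def fnet (σ : ℝ → ℝ) (K L r d : ℕ) (w : NNIdx K L r d → ℝ) (x : Fin d → ℝ) : ℝ :=
  if h : 0 < r then ∑ k : Fin K, w (NNIdx.out k) * nOut σ K L r d w k L ⟨0, h⟩ x else 0


/-- Truncation `T_β z = max{-β, min{β, z}}`. -/
def trunc (β z : ℝ) : ℝ := max (-β) (min β z)

/-- For `I = {j₁ < … < j_{d*}} ⊆ {1,…,d}`, the restricted vector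
`x_I = (x^{(j₁)},…,x^{(j_{d*})})`. -/
noncomputable def coordRestrict (d ds : ℕ) (S : {S : Finset (Fin d) // S.card = ds})
    (x : Fin d → ℝ) : Fin ds → ℝ :=
  fun i => x (S.1.orderIsoOfFin S.2 i)

/-- The interaction-model network `f_w(x) = ∑_{I ⊆ {1,…,d}, |I| = d*} f_{w_I}(x_I)`. -/
noncomputable def fnetInter (σ : ℝ → ℝ) (K L r d ds : ℕ)
    (w : {S : Finset (Fin d) // S.card = ds} → NNIdx K L r ds → ℝ)
    (x : Fin d → ℝ) : ℝ :=
  ∑ S : {S : Finset (Fin d) // S.card = ds},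
    fnet σ K L r ds (w S) (coordRestrict d ds S x)

/-- `g₁,…,g_N` (given as `g : Fin N → _`) is an `L_p` `ε`-cover of the function class `G`
on the points `x_1^n`. -/
def IsLpCover {d : ℕ} (p ε : ℝ) (G : Set ((Fin d → ℝ) → ℝ)) {n : ℕ}
    (xs : Fin n → Fin d → ℝ) {N : ℕ} (g : Fin N → (Fin d → ℝ) → ℝ) : Prop :=
  ∀ f ∈ G, ∃ i : Fin N,
    ((n : ℝ)⁻¹ * ∑ s : Fin n, |f (xs s) - g i (xs s)| ^ p) ^ (1 / p) < ε


lemma kt_cover {G : Type*} [NormedAddCommGroup G] [ProperSpace G] (τ : ℝ) :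
    ∃ T : ℕ, 0 < T ∧ ∃ q : G → Fin T, ∀ a b, ‖a‖ ≤ τ → ‖b‖ ≤ τ → q a = q b → ‖a - b‖ ≤ 1 := by
  obtain ⟨t, -, ht, hcov⟩ := (isCompact_closedBall (0:G) τ).finite_cover_balls
    (show (0:ℝ) < 1/2 by norm_num)
  have := ht.fintype
  have hx : ∀ a : G, ∃ y : Option t, ‖a‖ ≤ τ → ∃ z : t, y = some z ∧ dist a z < 1/2 := by
    intro a
    by_cases h : ‖a‖ ≤ τ
    · have := hcov (show a ∈ Metric.closedBall 0 τ by simpa using h)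
      simp only [Set.mem_iUnion, Metric.mem_ball] at this
      obtain ⟨z, hz, hd⟩ := this
      exact ⟨some ⟨z, hz⟩, fun _ => ⟨⟨z, hz⟩, rfl, hd⟩⟩
    · exact ⟨none, fun h' => absurd h' h⟩
  choose q hq using hx
  refine ⟨Fintype.card (Option t), Fintype.card_pos, fun a => Fintype.equivFin _ (q a), ?_⟩
  intro a b ha hb hab
  have hab := (Fintype.equivFin _).injective hab
  obtain ⟨z, hz, hz'⟩ := hq a ha
  obtain ⟨y, hy, hy'⟩ := hq b hb
  have : z = y := by
    rw [hz, hy] at hab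
    exact Option.some.inj hab
  subst this
  rw [← dist_eq_norm]
  have := dist_triangle_right a b (z:G)
  linarith

lemma kt_refine {H G : Type*} [NormedAddCommGroup G] [NormedSpace ℝ G] {τ : ℝ} {T : ℕ}
    (q : G → Fin T)
    (hq : ∀ a b, ‖a‖ ≤ τ → ‖b‖ ≤ τ → q a = q b → ‖a - b‖ ≤ 1) {s : ℝ} (hs : 0 < s)
    (φ : H → G) {N : ℕ} (c : H → Fin N)
    (hc : ∀ f g, c f = c g → ‖φ f - φ g‖ ≤ τ * s) :
    ∃ c' : H → Fin (N * T), ∀ f g, c' f = c' g → c f = c g ∧ ‖φ f - φ g‖ ≤ s := by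
  have hrep : ∀ n : Fin N, ∃ a : G, ∀ f, c f = n → ‖φ f - a‖ ≤ τ * s := by
    intro n
    by_cases h : ∃ g, c g = n
    · obtain ⟨g, hg⟩ := h
      exact ⟨φ g, fun f hf => hc f g (hf.trans hg.symm)⟩
    · exact ⟨0, fun f hf => absurd ⟨f, hf⟩ h⟩
  choose a ha using hrep
  refine ⟨fun f => finProdFinEquiv (c f, q (s⁻¹ • (φ f - a (c f)))), ?_⟩
  intro f g h
  have h := finProdFinEquiv.injective h
  simp only [Prod.mk.injEq] at h
  obtain ⟨h1, h2⟩ := h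
  refine ⟨h1, ?_⟩
  have key : ∀ f, ‖s⁻¹ • (φ f - a (c f))‖ ≤ τ := by
    intro f
    rw [norm_smul, norm_inv, Real.norm_eq_abs, abs_of_pos hs, inv_mul_le_iff₀ hs, mul_comm]
    exact ha _ f rfl
  have := hq _ _ (key f) (key g) h2
  rw [h1, ← smul_sub, norm_smul, norm_inv, Real.norm_eq_abs, abs_of_pos hs, inv_mul_le_iff₀ hs]
    at this
  simpa using this

lemma kt_root {H G : Type*} [NormedAddCommGroup G] [NormedSpace ℝ G] {τ : ℝ} (hτ : 2 ≤ τ) {T : ℕ}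
    (q : G → Fin T)
    (hq : ∀ a b, ‖a‖ ≤ τ → ‖b‖ ≤ τ → q a = q b → ‖a - b‖ ≤ 1) (φ : H → G) (j : ℕ) :
    ∀ {s : ℝ}, 0 < s → (∀ f g, ‖φ f - φ g‖ ≤ 2 ^ j * s) →
    ∃ c : H → Fin (T ^ j), ∀ f g, c f = c g → ‖φ f - φ g‖ ≤ s := by
  induction j with
  | zero => 
    intro s hs h
    exact ⟨fun _ => ⟨0, by simp⟩, fun f g _ => by simpa using h f g⟩
  | succ j ih =>
    intro s hs h
    obtain ⟨c, hc⟩ := ih (s := 2 * s) (by positivity) (fun f g => by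
      have := h f g; rw [pow_succ] at this; linarith)
    obtain ⟨c', hc'⟩ := kt_refine q hq hs φ c (fun f g hfg => (hc f g hfg).trans (by gcongr))
    exact ⟨c', fun f g h => (hc' f g h).2⟩

lemma kt_chain {H G : Type*} [NormedAddCommGroup G] [NormedSpace ℝ G] {τ : ℝ} {T : ℕ}
    (q : G → Fin T)
    (hq : ∀ a b, ‖a‖ ≤ τ → ‖b‖ ≤ τ → q a = q b → ‖a - b‖ ≤ 1) {ds : ℕ} {s : ℝ} (hs : 0 < s)
    (φ : (Fin ds → ℕ) → H → G)
    (hstep : ∀ v f g, ‖φ (v - 1) f - φ (v - 1) g‖ ≤ s → ‖φ v f - φ v g‖ ≤ τ * s)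
    {N : ℕ} (c : H → Fin N) (hc : ∀ f g, c f = c g → ‖φ 0 f - φ 0 g‖ ≤ s)
    (W : Finset (Fin ds → ℕ)) :
    (∀ v ∈ W, v - 1 ∈ W) → 
    ∃ c' : H → Fin (N * T ^ W.card), ∀ f g, c' f = c' g → c f = c g ∧
      ∀ v ∈ W, ‖φ v f - φ v g‖ ≤ s := by
  induction W using Finset.induction_on_max_value (fun v : Fin ds → ℕ => ∑ i, v i) with
  | empty => intro _; exact ⟨fun f => Fin.cast (by simp) (c f), fun f g h => ⟨Fin.cast_injective _ h, by simp⟩⟩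
  | insert a W ha hmax ih =>
    intro hcl
    have hlt : ∀ v : Fin ds → ℕ, v ≠ 0 → ∑ i, (v - 1) i < ∑ i, v i := by
      intro v hv
      obtain ⟨i, hi⟩ := Function.ne_iff.1 hv
      refine Finset.sum_lt_sum (fun i _ => by simp) ⟨i, Finset.mem_univ _, ?_⟩
      simp at hi ⊢
      omega
    have h0 : (0 : Fin ds → ℕ) - 1 = 0 := by ext; simp
    have hcl' : ∀ v ∈ W, v - 1 ∈ W := by
      intro v hv
      by_cases h : v = 0
      · subst h; rw [h0]; exact hv
      · rcases Finset.mem_insert.1 (hcl v (Finset.mem_insert_of_mem hv)) with h1 | h1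
        · have h2 := hlt v h
          have h3 := hmax v hv
          rw [h1] at h2; omega
        · exact h1
    obtain ⟨c', hc'⟩ := ih hcl'
    have hpre : ∀ f g, c' f = c' g → ‖φ a f - φ a g‖ ≤ τ * s := by
      intro f g h
      apply hstep
      by_cases h1 : a = 0
      · subst h1; rw [h0]; exact hc f g (hc' f g h).1
      · rcases Finset.mem_insert.1 (hcl a (Finset.mem_insert_self _ _)) with h2 | h2
        · have := hlt a h1; rw [h2] at this; omega
        · exact (hc' f g h).2 _ h2
    obtain ⟨c'', hc''⟩ := kt_refine q hq hs (φ a) c' hpre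
    refine ⟨fun f => Fin.cast (by rw [Finset.card_insert_of_notMem ha, pow_succ, mul_assoc]) (c'' f),
      fun f g h => ?_⟩
    have h := hc'' f g (by simpa using h)
    refine ⟨(hc' f g h.1).1, fun v hv => ?_⟩
    rcases Finset.mem_insert.1 hv with rfl | hv
    · exact h.2
    · exact (hc' f g h.1).2 v hv

lemma kt_prop {E : Type*} [NormedAddCommGroup E] [NormedSpace ℝ E] {k : ℕ} {h : E → ℝ}
    (hh : ContDiff ℝ k h) {lam e : ℝ} (hl : 0 < lam) (he : 0 < e) (v : E)
    (hk : ∀ x, lam ^ k * ‖iteratedFDeriv ℝ k h x‖ ≤ 2 * e)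
    (hv : ∀ m < k, lam ^ m * ‖iteratedFDeriv ℝ m h v‖ ≤ e) (j : ℕ) :
    ∀ m, m + j = k → ∀ x ∈ Metric.closedBall v lam,
      lam ^ m * ‖iteratedFDeriv ℝ m h x‖ ≤ (2 + j) * e := by
  induction j with
  | zero => intro m hm x _; simp at hm; subst hm; simpa using hk x
  | succ j ih =>
    intro m hm x hx
    have hd : ∀ y, DifferentiableAt ℝ (iteratedFDeriv ℝ m h) y := fun y =>
      (hh.differentiable_iteratedFDeriv (by exact_mod_cast (by omega : m < k))) y
    have ih' := ih (m + 1) (by omega)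
    have key := (convex_closedBall v lam).norm_image_sub_le_of_norm_fderiv_le (𝕜 := ℝ)
      (f := iteratedFDeriv ℝ m h) (C := (2 + j) * e / lam ^ (m + 1)) (fun y _ => hd y)
      (fun y hy => by
        rw [norm_fderiv_iteratedFDeriv, le_div_iff₀ (by positivity), mul_comm]
        exact ih' y hy)
      (Metric.mem_closedBall_self hl.le) hx
    have hx' : ‖x - v‖ ≤ lam := by rwa [← dist_eq_norm]
    have h1 := hv m (by omega)
    have h2 : lam ^ m * ‖iteratedFDeriv ℝ m h x - iteratedFDeriv ℝ m h v‖ ≤ (2 + j) * e := by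
      calc _ ≤ lam ^ m * ((2 + j) * e / lam ^ (m + 1) * lam) := by
            gcongr
            exact key.trans (by gcongr)
        _ = _ := by field_simp; ring
    have h3 : ‖iteratedFDeriv ℝ m h x‖ ≤ ‖iteratedFDeriv ℝ m h x - iteratedFDeriv ℝ m h v‖
        + ‖iteratedFDeriv ℝ m h v‖ := by
      simpa using norm_add_le (iteratedFDeriv ℝ m h x - iteratedFDeriv ℝ m h v)
        (iteratedFDeriv ℝ m h v)
    calc _ ≤ lam ^ m * (‖iteratedFDeriv ℝ m h x - iteratedFDeriv ℝ m h v‖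
        + ‖iteratedFDeriv ℝ m h v‖) := by gcongr
      _ ≤ (2 + j) * e + e := by rw [mul_add]; gcongr
      _ = _ := by push_cast; ring

lemma kt_findim {ι : Type*} [Fintype ι] (m : ℕ) :
    FiniteDimensional ℝ ((ι → ℝ) [×m]→L[ℝ] ℝ) := by
  exact FiniteDimensional.of_injective
    (ContinuousMultilinearMap.toMultilinearMapLinear : ((ι → ℝ) [×m]→L[ℝ] ℝ) →ₗ[ℝ] _)
    ContinuousMultilinearMap.toMultilinearMap_injective

/-- The weighted jet of `f` at `v`. -/
noncomputable def ktJet (k ds : ℕ) (lam : ℝ) (v : Fin ds → ℝ) (f : (Fin ds → ℝ) → ℝ) :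
    (m : Fin k) → ((Fin ds → ℝ) [×(m : ℕ)]→L[ℝ] ℝ) :=
  fun m => lam ^ (m : ℕ) • iteratedFDeriv ℝ m f v

lemma kt_smul_aux {G : Type*} [NormedAddCommGroup G] [NormedSpace ℝ G] (r : ℝ) (a b : G) :
    ‖r • a - r • b‖ = |r| * ‖a - b‖ := by
  rw [← smul_sub, norm_smul, Real.norm_eq_abs]

lemma ktJet_sub {k ds : ℕ} {lam : ℝ} {v : Fin ds → ℝ} {f g : (Fin ds → ℝ) → ℝ}
    (hf : ContDiff ℝ k f) (hg : ContDiff ℝ k g) (hl : 0 < lam) {e : ℝ} (he : 0 ≤ e) :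
    ‖ktJet k ds lam v f - ktJet k ds lam v g‖ ≤ e ↔
      ∀ m < k, lam ^ m * ‖iteratedFDeriv ℝ m (f - g) v‖ ≤ e := by
  rw [pi_norm_le_iff_of_nonneg he]
  have : ∀ m : Fin k, ‖(ktJet k ds lam v f - ktJet k ds lam v g) m‖ =
      lam ^ (m : ℕ) * ‖iteratedFDeriv ℝ m (f - g) v‖ := by
    intro m
    have hm : ((m : ℕ) : WithTop ℕ∞) ≤ k := by exact_mod_cast m.2.le
    rw [iteratedFDeriv_sub (hf.of_le hm) (hg.of_le hm)]
    simp only [ktJet, Pi.sub_apply]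
    have gen : ∀ (n : ℕ) (a b : (Fin ds → ℝ) [×n]→L[ℝ] ℝ),
        ‖lam ^ n • a - lam ^ n • b‖ = lam ^ n * ‖a - b‖ := by
      intro n a b
      exact (kt_smul_aux _ a b).trans (by rw [abs_of_pos (pow_pos hl n)])
    exact gen _ _ _
  simp only [this]
  exact ⟨fun h m hm => h ⟨m, hm⟩, fun h m => h m m.2⟩

lemma kt_main (ds k : ℕ) (hk : 0 < k) : ∃ T : ℕ, 0 < T ∧ ∀ (lam e V : ℝ), 0 < lam → 0 < e →
    ∀ (H : Set ((Fin ds → ℝ) → ℝ)), (∀ f ∈ H, ContDiff ℝ k f) →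
    (∀ f ∈ H, ∀ x, lam ^ k * ‖iteratedFDeriv ℝ k f x‖ ≤ e) →
    (∀ f ∈ H, ∀ m < k, ∀ x, lam ^ m * ‖iteratedFDeriv ℝ m f x‖ ≤ V) →
    ∀ (j n : ℕ) (v0 : ℝ), 2 * V ≤ 2 ^ j * e →
    ∃ c : H → Fin (T ^ (j + (n + 1) ^ ds)), ∀ f g : H, c f = c g → ∀ x : Fin ds → ℝ,
      (∀ i, v0 ≤ x i ∧ x i < v0 + lam * (n + 1)) → |f.1 x - g.1 x| ≤ (2 + k) * e := by
  have := fun m : ℕ => kt_findim (ι := Fin ds) m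
  have hP : ProperSpace ((m : Fin k) → ((Fin ds → ℝ) [×(m : ℕ)]→L[ℝ] ℝ)) :=
    FiniteDimensional.proper ℝ _
  obtain ⟨T, hT, q, hq⟩ := kt_cover
    (G := (m : Fin k) → ((Fin ds → ℝ) [×(m : ℕ)]→L[ℝ] ℝ)) (2 + k)
  refine ⟨T, hT, ?_⟩
  intro lam e V hl he H hH hHk hHV j n v0 hj
  have hsubk : ∀ f g : H, ∀ m ≤ k, ∀ x, iteratedFDeriv ℝ m (f.1 - g.1) x =
      iteratedFDeriv ℝ m f.1 x - iteratedFDeriv ℝ m g.1 x := by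
    intro f g m hm x
    have hm : (m : WithTop ℕ∞) ≤ k := by exact_mod_cast hm
    rw [iteratedFDeriv_sub ((hH _ f.2).of_le hm) ((hH _ g.2).of_le hm)]; rfl
  have hprop : ∀ f g : H, ∀ v x : Fin ds → ℝ, x ∈ Metric.closedBall v lam →
      ‖ktJet k ds lam v f.1 - ktJet k ds lam v g.1‖ ≤ e →
      ∀ m < k, lam ^ m * ‖iteratedFDeriv ℝ m (f.1 - g.1) x‖ ≤ (2 + k) * e := by
    intro f g v x hx hfg m hm
    rw [ktJet_sub (hH _ f.2) (hH _ g.2) hl he.le] at hfg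
    refine (kt_prop ((hH _ f.2).sub (hH _ g.2)) hl he v ?_ hfg (k - m) m (by omega) x hx).trans ?_
    · intro x
      have : ‖iteratedFDeriv ℝ k (f.1 - g.1) x‖ ≤ _ :=
        (congrArg norm (hsubk f g k le_rfl x)).trans_le (norm_sub_le _ _)
      calc _ ≤ lam ^ k * (‖iteratedFDeriv ℝ k f.1 x‖ + ‖iteratedFDeriv ℝ k g.1 x‖) :=
            mul_le_mul_of_nonneg_left this (by positivity)
        _ ≤ _ := by
          have := hHk _ f.2 x
          have := hHk _ g.2 x
          linarith
    · gcongr; exact_mod_cast Nat.sub_le k m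
  let P : (Fin ds → ℕ) → (Fin ds → ℝ) := fun v i => v0 + lam * v i
  let φ : (Fin ds → ℕ) → H → ((m : Fin k) → ((Fin ds → ℝ) [×(m : ℕ)]→L[ℝ] ℝ)) :=
    fun v f => ktJet k ds lam (P v) f.1
  obtain ⟨c0, hc0⟩ := kt_root (by simp) q hq (φ 0) j he (by
    intro f g
    rw [ktJet_sub (hH _ f.2) (hH _ g.2) hl (by positivity)]
    intro m hm
    rw [hsubk f g m hm.le]
    calc _ ≤ lam ^ m * (‖iteratedFDeriv ℝ m f.1 (P 0)‖ + ‖iteratedFDeriv ℝ m g.1 (P 0)‖) := by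
            gcongr; exact norm_sub_le _ _
        _ ≤ _ := by
          have := hHV _ f.2 m hm (P 0)
          have := hHV _ g.2 m hm (P 0)
          linarith)
  obtain ⟨c, hc⟩ := kt_chain q hq he φ (by
    intro v f g hfg
    rw [ktJet_sub (hH _ f.2) (hH _ g.2) hl (by positivity)]
    refine hprop f g (P (v - 1)) (P v) ?_ hfg
    rw [Metric.mem_closedBall, dist_pi_le_iff hl.le]
    intro i
    simp only [P, Real.dist_eq]
    have : |(v i : ℝ) - ((v - 1) i : ℕ)| ≤ 1 := by
      rcases Nat.eq_zero_or_pos (v i) with h | h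
      · simp [h]
      · have : (v - 1) i = v i - 1 := rfl
        rw [this, Nat.cast_sub h]; simp
    calc _ = lam * |(v i : ℝ) - ((v - 1) i : ℕ)| := by
            rw [← abs_of_pos hl, ← abs_mul, abs_of_pos hl]; ring_nf
      _ ≤ lam := by nlinarith) c0 hc0 (Fintype.piFinset fun _ => Finset.range (n + 1)) (by
    intro v hv
    simp only [Fintype.mem_piFinset, Finset.mem_range] at hv ⊢
    intro i; have := hv i; simp; omega)
  refine ⟨fun f => Fin.cast (by simp [pow_add]) (c f), ?_⟩
  intro f g hfg x hx
  have h1 := (hc f g (by simpa using hfg)).2 (fun i => ⌊(x i - v0) / lam⌋₊) (by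
    simp only [Fintype.mem_piFinset, Finset.mem_range]
    intro i
    rw [Nat.floor_lt (div_nonneg (by linarith [(hx i).1]) hl.le), div_lt_iff₀ hl]
    push_cast
    linarith [(hx i).2])
  have h2 := hprop f g _ x (by
    rw [Metric.mem_closedBall, dist_pi_le_iff hl.le]
    intro i
    simp only [P, Real.dist_eq]
    have h1 := Nat.floor_le (div_nonneg (sub_nonneg.2 (hx i).1) hl.le)
    have h2 := Nat.lt_floor_add_one ((x i - v0) / lam)
    rw [le_div_iff₀ hl] at h1
    rw [div_lt_iff₀ hl] at h2
    rw [abs_le]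
    constructor <;> nlinarith) h1 0 hk
  simpa using h2

lemma kt_norm_smul_aux {G : Type*} [NormedAddCommGroup G] [NormedSpace ℝ G] (r : ℝ) (a : G) :
    ‖r • a‖ = |r| * ‖a‖ := by
  rw [norm_smul, Real.norm_eq_abs]

lemma kt_lin {E : Type*} [NormedAddCommGroup E] [NormedSpace ℝ E] {ι : Type*} [Fintype ι]
    (w : ι → ℝ) (f : ι → E → ℝ) (i : ℕ) (hf : ∀ j, ContDiff ℝ i (f j)) (x : E) (b : ℝ)
    (hb : ∀ j, ‖iteratedFDeriv ℝ i (f j) x‖ ≤ b) :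
    ‖iteratedFDeriv ℝ i (fun x => ∑ j, w j * f j x) x‖ ≤ (∑ j, |w j|) * b := by
  have h1 : iteratedFDeriv ℝ i (fun x => ∑ j, w j * f j x) x =
      ∑ j, iteratedFDeriv ℝ i (fun x => w j * f j x) x :=
    iteratedFDeriv_fun_sum_apply (fun j _ => (contDiff_const.mul (hf j)).contDiffAt)
  rw [h1, Finset.sum_mul]
  refine (norm_sum_le _ _).trans (Finset.sum_le_sum fun j _ => ?_)
  have h2 : iteratedFDeriv ℝ i (fun x => w j * f j x) x = w j • iteratedFDeriv ℝ i (f j) x :=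
    iteratedFDeriv_const_smul_apply' (a := w j) (hf j).contDiffAt
  rw [h2]
  have h3 := kt_norm_smul_aux (w j) (iteratedFDeriv ℝ i (f j) x)
  refine h3.le.trans ?_
  exact mul_le_mul_of_nonneg_left (hb j) (abs_nonneg _)

lemma kt_coord {ι : Type*} [Fintype ι] (j : ι) (x : ι → ℝ) (i : ℕ) (hi : 1 ≤ i) :
    ‖iteratedFDeriv ℝ i (fun x : ι → ℝ => x j) x‖ ≤ 1 := by
  obtain ⟨n, rfl⟩ : ∃ n, i = n + 1 := ⟨i - 1, by omega⟩
  rw [← norm_iteratedFDeriv_fderiv]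
  have h : fderiv ℝ (fun x : ι → ℝ => x j) =
      fun _ => ContinuousLinearMap.proj (R := ℝ) (φ := fun _ : ι => ℝ) j := by
    ext1 y
    exact (ContinuousLinearMap.proj (R := ℝ) (φ := fun _ : ι => ℝ) j).fderiv
  rw [h]
  rcases Nat.eq_zero_or_pos n with rfl | hn
  · rw [norm_iteratedFDeriv_zero]
    refine ContinuousLinearMap.opNorm_le_bound _ zero_le_one fun y => ?_
    rw [one_mul]
    exact norm_le_pi_norm y j
  · rw [iteratedFDeriv_const_of_ne (by omega)]
    simp

lemma kt_sigma (σ : ℝ → ℝ) (k : ℕ) (hσ : ContDiff ℝ k σ)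
    (hσbdd : ∀ i ≤ k, ∃ M : ℝ, ∀ x, |iteratedDeriv i σ x| ≤ M) :
    ∃ M : ℝ, 1 ≤ M ∧ ∀ {E : Type} [NormedAddCommGroup E] [NormedSpace ℝ E] (g : E → ℝ) (b D : ℝ),
      ContDiff ℝ k g → (x : E) → (∀ i, 1 ≤ i → i ≤ k → ‖iteratedFDeriv ℝ i g x‖ ≤ D ^ i) →
      0 ≤ D → ∀ n ≤ k, ‖iteratedFDeriv ℝ n (fun x => σ (g x + b)) x‖ ≤ M * D ^ n := by
  choose! M hM using hσbdd
  let M' := 1 + ∑ i ∈ Finset.range (k + 1), |M i|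
  have hM' : ∀ i ≤ k, ∀ x, |iteratedDeriv i σ x| ≤ M' := by
    intro i hi x
    have := Finset.single_le_sum (f := fun i => |M i|) (s := Finset.range (k + 1))
      (fun i _ => abs_nonneg _) (Finset.mem_range.2 (by omega : i < k + 1))
    have h1 := hM i hi x
    have h2 := le_abs_self (M i)
    simp only [M']
    linarith
  have hM1 : 1 ≤ M' := by
    simp only [M', le_add_iff_nonneg_right]
    exact Finset.sum_nonneg fun i _ => abs_nonneg _
  have hk1 : (1:ℝ) ≤ k.factorial := by exact_mod_cast Nat.factorial_pos k
  refine ⟨k.factorial * M', by nlinarith, ?_⟩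
  intro E _ _ g b D hg x hD hD0 n hn
  have hτ : ContDiff ℝ k (fun y => σ (y + b)) := hσ.comp (contDiff_id.add contDiff_const)
  have := norm_iteratedFDeriv_comp_le (g := fun y => σ (y + b)) (f := g) (n := n) hτ hg
    (by exact_mod_cast hn) x (C := M') (D := D) (by
      intro i hi
      rw [iteratedFDeriv_comp_add_right, norm_iteratedFDeriv_eq_norm_iteratedDeriv]
      exact hM' i (hi.trans hn) _) (fun i h1 h2 => hD i h1 (h2.trans hn))
  refine this.trans ?_
  have : (n.factorial : ℝ) ≤ k.factorial := by exact_mod_cast Nat.factorial_le hn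
  gcongr

lemma kt_nOut (σ : ℝ → ℝ) (k L r ds : ℕ) (hσ : ContDiff ℝ k σ)
    (hσbdd : ∀ i ≤ k, ∃ M : ℝ, ∀ x, |iteratedDeriv i σ x| ≤ M) (l : ℕ) :
    ∃ c : ℝ, 1 ≤ c ∧ ∀ (K : ℕ) (A B : ℝ), 1 ≤ A → 1 ≤ B → ∀ w : NNIdx K L r ds → ℝ,
      (∀ (kk : Fin K) (i : Fin r) (l : Fin (L - 1)) (j : Fin r),
        |w (NNIdx.inner l kk i j.succ)| ≤ B) →
      (∀ (kk : Fin K) (i : Fin r) (j : Fin ds), |w (NNIdx.input kk i j.succ)| ≤ A) →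
      ∀ kk i, ContDiff ℝ k (nOut σ K L r ds w kk l i) ∧
        ∀ n ≤ k, ∀ x, ‖iteratedFDeriv ℝ n (nOut σ K L r ds w kk l i) x‖ ≤
          c * (c * A * B ^ (l - 1)) ^ n := by
  obtain ⟨M, hM1, hM⟩ := kt_sigma σ k hσ hσbdd
  have zero_case : ∀ (c A B : ℝ) (l n : ℕ) (x : Fin ds → ℝ), 1 ≤ c → 1 ≤ A → 1 ≤ B → 
      ‖iteratedFDeriv ℝ n (fun _ : Fin ds → ℝ => (0:ℝ)) x‖ ≤ c * (c * A * B ^ (l - 1)) ^ n := by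
    intro c A B l n x hc hA hB
    have : iteratedFDeriv ℝ n (fun _ : Fin ds → ℝ => (0:ℝ)) = 0 := iteratedFDeriv_fun_zero
    rw [this, Pi.zero_apply, norm_zero]
    positivity
  have hcomp : ∀ c₀ : ℝ, M ≤ c₀ → ∀ D Q : ℝ, 0 ≤ D → D ≤ Q → ∀ n : ℕ, M * D ^ n ≤ c₀ * Q ^ n := by
    intro c₀ h D Q h1 h2 n
    gcongr
    linarith
  induction l with
  | zero =>
    refine ⟨1, le_rfl, ?_⟩
    intro K A B hA hB w hw1 hw2 kk i
    have : nOut σ K L r ds w kk 0 i = fun _ => 0 := by ext; simp [nOut]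
    rw [this]
    exact ⟨contDiff_const, fun n _ x => zero_case _ _ _ _ _ _ le_rfl hA hB⟩
  | succ l ih =>
    rcases Nat.eq_zero_or_pos l with rfl | hl
    · refine ⟨M + (ds + 1), by linarith [(Nat.cast_nonneg ds : (0:ℝ) ≤ ds)], ?_⟩
      intro K A B hA hB w hw1 hw2 kk i
      have h0 : nOut σ K L r ds w kk (0 + 1) i = fun x =>
        σ ((∑ j : Fin ds, w (NNIdx.input kk i j.succ) * x j) + w (NNIdx.input kk i 0)) := by
          ext; simp [nOut]
      have hg : ContDiff ℝ k (fun x : Fin ds → ℝ => ∑ j : Fin ds, w (NNIdx.input kk i j.succ) * x j) := by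
        fun_prop
      rw [h0]
      refine ⟨hσ.comp (hg.add contDiff_const), fun n hn x => ?_⟩
      refine (hM _ _ ((ds + 1) * A) hg x ?_ (by positivity) n hn).trans ?_
      · intro i' hi1 hi2
        refine (kt_lin _ (fun j (x : Fin ds → ℝ) => x j) i' (fun j => by fun_prop) x 1
          (fun j => kt_coord j x i' hi1)).trans ?_
        have : ∑ j : Fin ds, |w (NNIdx.input kk i j.succ)| ≤ ds * A := by
          refine (Finset.sum_le_sum fun j _ => hw2 kk i j).trans ?_
          simp
        have h1 : (1:ℝ) ≤ (ds + 1) * A := by nlinarith [(Nat.cast_nonneg ds : (0:ℝ) ≤ ds)]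
        have := le_self_pow₀ h1 (by omega : i' ≠ 0)
        linarith
      · apply hcomp
        · linarith [(Nat.cast_nonneg ds : (0:ℝ) ≤ ds)]
        · positivity
        · simp only [zero_add, le_refl, tsub_eq_zero_of_le, pow_zero, mul_one]
          exact mul_le_mul_of_nonneg_right (by linarith) (by linarith)
    · obtain ⟨c, hc, ih⟩ := ih
      obtain ⟨l, rfl⟩ : ∃ l', l = l' + 1 := ⟨l - 1, by omega⟩
      have hr0 : (0:ℝ) ≤ r := Nat.cast_nonneg r
      refine ⟨M + (r + 1) * c * c, by nlinarith [mul_nonneg hr0 (by positivity : 0 ≤ c * c), mul_self_nonneg c], ?_⟩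
      intro K A B hA hB w hw1 hw2 kk i
      by_cases h : l < L - 1
      swap
      · have : nOut σ K L r ds w kk (l + 1 + 1) i = fun _ => 0 := by ext; simp [nOut, h]
        rw [this]
        exact ⟨contDiff_const, fun n _ x => zero_case _ _ _ _ _ _
          (by nlinarith [mul_nonneg hr0 (by positivity : 0 ≤ c * c), mul_self_nonneg c]) hA hB⟩
      have h0 : nOut σ K L r ds w kk (l + 1 + 1) i = fun x =>
        σ ((∑ j : Fin r, w (NNIdx.inner ⟨l, h⟩ kk i j.succ) * nOut σ K L r ds w kk (l + 1) j x)
          + w (NNIdx.inner ⟨l, h⟩ kk i 0)) := by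
          ext; simp [nOut, h]
      have ihk := fun j => ih K A B hA hB w hw1 hw2 kk j
      have hg : ContDiff ℝ k (fun x : Fin ds → ℝ =>
          ∑ j : Fin r, w (NNIdx.inner ⟨l, h⟩ kk i j.succ) * nOut σ K L r ds w kk (l + 1) j x) :=
        ContDiff.sum fun j _ => contDiff_const.mul (ihk j).1
      rw [h0]
      refine ⟨hσ.comp (hg.add contDiff_const), fun n hn x => ?_⟩
      simp only [Nat.add_sub_cancel] at ihk
      refine (hM _ _ (((r + 1) * c * B) * (c * A * B ^ l)) hg x ?_ (by positivity) n hn).trans ?_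
      · intro i' hi1 hi2
        refine (kt_lin _ _ i' (fun j => (ihk j).1.of_le (by exact_mod_cast hi2)) x _
          (fun j => (ihk j).2 i' hi2 x)).trans ?_
        have : ∑ j : Fin r, |w (NNIdx.inner ⟨l, h⟩ kk i j.succ)| ≤ r * B := by
          refine (Finset.sum_le_sum fun j _ => hw1 kk i _ j).trans ?_
          simp
        have h1 : (1:ℝ) ≤ (r + 1) * c * B := by
          have : (1:ℝ) ≤ r + 1 := by linarith
          exact one_le_mul_of_one_le_of_one_le (one_le_mul_of_one_le_of_one_le this hc) hB
        have h2 := le_self_pow₀ h1 (by omega : i' ≠ 0)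
        rw [mul_pow (((r:ℝ) + 1) * c * B), ← mul_assoc]
        refine mul_le_mul_of_nonneg_right (le_trans ?_ h2) (by positivity)
        calc _ ≤ r * B * c := by gcongr
          _ ≤ _ := by nlinarith [mul_nonneg (by linarith : 0 ≤ c) (by linarith : 0 ≤ B)]
      · apply hcomp
        · nlinarith [mul_nonneg hr0 (by positivity : 0 ≤ c * c), mul_self_nonneg c]
        · positivity
        · simp only [Nat.add_sub_cancel]
          calc _ = (r + 1) * c * c * A * B ^ (l + 1) := by ring
            _ ≤ _ := by gcongr; linarith

lemma kt_fnet (σ : ℝ → ℝ) (k L r ds : ℕ) (hσ : ContDiff ℝ k σ)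
    (hσbdd : ∀ i ≤ k, ∃ M : ℝ, ∀ x, |iteratedDeriv i σ x| ≤ M) :
    ∃ c : ℝ, 1 ≤ c ∧ ∀ (K : ℕ) (A B C : ℝ), 1 ≤ A → 1 ≤ B → 1 ≤ C → ∀ w : NNIdx K L r ds → ℝ,
      (∑ j : Fin K, |w (NNIdx.out j)| ≤ C) →
      (∀ (kk : Fin K) (i : Fin r) (l : Fin (L - 1)) (j : Fin r),
        |w (NNIdx.inner l kk i j.succ)| ≤ B) →
      (∀ (kk : Fin K) (i : Fin r) (j : Fin ds), |w (NNIdx.input kk i j.succ)| ≤ A) →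
      ContDiff ℝ k (fnet σ K L r ds w) ∧
        ∀ n ≤ k, ∀ x, ‖iteratedFDeriv ℝ n (fnet σ K L r ds w) x‖ ≤
          C * c * (c * A * B ^ (L - 1)) ^ n := by
  obtain ⟨c, hc, hn⟩ := kt_nOut σ k L r ds hσ hσbdd L
  refine ⟨c, hc, ?_⟩
  intro K A B C hA hB hC w hw hw1 hw2
  by_cases h : 0 < r
  · have h0 : fnet σ K L r ds w = fun x => ∑ k : Fin K, w (NNIdx.out k) *
        nOut σ K L r ds w k L ⟨0, h⟩ x := by ext; simp [fnet, h]
    rw [h0]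
    have hn := fun kk => hn K A B hA hB w hw1 hw2 kk ⟨0, h⟩
    refine ⟨ContDiff.sum fun j _ => contDiff_const.mul (hn j).1, fun n hnk x => ?_⟩
    refine (kt_lin _ _ n (fun j => (hn j).1.of_le (by exact_mod_cast hnk)) x _
          (fun j => (hn j).2 n hnk x)).trans ?_
    rw [mul_assoc C]
    gcongr
  · have h0 : fnet σ K L r ds w = fun x => 0 := by ext; simp [fnet, h]
    rw [h0]
    refine ⟨contDiff_const, fun n _ x => ?_⟩
    have : iteratedFDeriv ℝ n (fun _ : Fin ds → ℝ => (0:ℝ)) = 0 := iteratedFDeriv_fun_zero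
    rw [this, Pi.zero_apply, norm_zero]
    positivity

lemma kt_lpmean {n : ℕ} (a : Fin n → ℝ) (p η : ℝ) (hp : 1 ≤ p) (hη : 0 ≤ η)
    (ha : ∀ s, 0 ≤ a s ∧ a s ≤ η) : ((n : ℝ)⁻¹ * ∑ s : Fin n, a s ^ p) ^ (1 / p) ≤ η := by
  have hp0 : 0 < p := by linarith
  have h1 : (n : ℝ)⁻¹ * ∑ s : Fin n, a s ^ p ≤ η ^ p := by
    have : ∑ s : Fin n, a s ^ p ≤ n * η ^ p := by
      refine (Finset.sum_le_sum fun s _ => Real.rpow_le_rpow (ha s).1 (ha s).2 hp0.le).trans ?_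
      simp
    rcases Nat.eq_zero_or_pos n with rfl | hn
    · simp; positivity
    · have : (0:ℝ) < n := by exact_mod_cast hn
      rw [inv_mul_le_iff₀ this]; assumption
  have h0 : 0 ≤ (n : ℝ)⁻¹ * ∑ s : Fin n, a s ^ p :=
    mul_nonneg (by positivity) (Finset.sum_nonneg fun s _ => Real.rpow_nonneg (ha s).1 _)
  calc _ ≤ (η ^ p) ^ (1 / p) := Real.rpow_le_rpow h0 h1 (by positivity)
    _ = η := by rw [← Real.rpow_mul hη, mul_one_div_cancel hp0.ne', Real.rpow_one]

lemma kt_trunc (β x y : ℝ) : |trunc β x - trunc β y| ≤ |x - y| := by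
  unfold trunc
  refine (abs_max_sub_max_le_max _ _ _ _).trans ?_
  refine max_le (by simp) ((abs_min_sub_min_le_max _ _ _ _).trans ?_)
  simp

lemma kt_cover_of_code {d n : ℕ} {W ι : Type} [Fintype ι] (F : W → (Fin d → ℝ) → ℝ) (code : W → ι)
    (xs : Fin n → Fin d → ℝ) (p ε η : ℝ) (hp : 1 ≤ p) (hη : 0 ≤ η) (hηε : η < ε)
    (h : ∀ w w', code w = code w' → ∀ s, |F w (xs s) - F w' (xs s)| ≤ η) :
    ∃ g : Fin (Fintype.card ι) → (Fin d → ℝ) → ℝ, IsLpCover p ε (Set.range F) xs g := by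
  have hrep : ∀ i : ι, ∃ g : (Fin d → ℝ) → ℝ, ∀ w, code w = i → ∀ s, |F w (xs s) - g (xs s)| ≤ η := by
    intro i
    by_cases hi : ∃ w, code w = i
    · obtain ⟨w', hw'⟩ := hi
      exact ⟨F w', fun w hw => h w w' (hw.trans hw'.symm)⟩
    · exact ⟨0, fun w hw => absurd ⟨w, hw⟩ hi⟩
  choose g hg using hrep
  refine ⟨fun i => g ((Fintype.equivFin ι).symm i), ?_⟩
  rintro _ ⟨w, rfl⟩
  refine ⟨Fintype.equivFin ι (code w), lt_of_le_of_lt (kt_lpmean _ p η hp hη fun s => ⟨abs_nonneg _, ?_⟩) hηε⟩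
  simp only [Equiv.symm_apply_apply]
  exact hg _ w rfl s

lemma kt_count (T E : ℕ) (hT : 0 < T) (β p ε X : ℝ) (hε : 0 < ε) (hεβ : ε < β) (hp : 1 ≤ p)
    (hX : (E : ℝ) ≤ X) : ((T ^ E : ℕ) : ℝ) ≤ (T * β ^ p / ε ^ p) ^ X := by
  have hT1 : (1:ℝ) ≤ T := by exact_mod_cast hT
  have h1 : 1 ≤ β ^ p / ε ^ p := by
    rw [one_le_div (Real.rpow_pos_of_pos hε p)]
    exact Real.rpow_le_rpow hε.le hεβ.le (by linarith)
  have h2 : (T : ℝ) ≤ T * β ^ p / ε ^ p := by rw [mul_div_assoc]; nlinarith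
  calc ((T ^ E : ℕ) : ℝ) = (T : ℝ) ^ (E : ℝ) := by rw [Real.rpow_natCast]; push_cast; rfl
    _ ≤ (T : ℝ) ^ X := Real.rpow_le_rpow_of_exponent_le hT1 hX
    _ ≤ _ := Real.rpow_le_rpow (by linarith) h2 (le_trans (Nat.cast_nonneg E) hX)

/-- choice of the dyadic depth -/
lemma kt_depth (U a : ℝ) (hU : 1 ≤ U) (ha : 0 < a) :
    ∃ j : ℕ, 2 * U ≤ 2 ^ j ∧ (j : ℝ) ≤ (2 + 2 / a) * U ^ a := by
  have hl2 : 1 / 2 < Real.log 2 := by linarith [Real.log_two_gt_d9]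
  refine ⟨⌈Real.logb 2 (2 * U)⌉₊, ?_, ?_⟩
  · have h := Nat.le_ceil (Real.logb 2 (2 * U))
    rw [Real.logb_le_iff_le_rpow (by norm_num) (by positivity), Real.rpow_natCast] at h
    exact h
  · have h0 : 0 ≤ Real.logb 2 (2 * U) := Real.logb_nonneg (by norm_num) (by linarith)
    have h := (Nat.ceil_lt_add_one h0).le
    have h1 : Real.logb 2 (2 * U) = 1 + Real.log U / Real.log 2 := by
      rw [Real.logb, Real.log_mul (by norm_num) (by positivity), add_div, div_self (by linarith)]
    have h2 := Real.log_le_rpow_div (by linarith : 0 ≤ U) ha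
    have hX : 1 ≤ U ^ a := Real.one_le_rpow hU ha.le
    have h3 : Real.log U / Real.log 2 ≤ 2 * (U ^ a / a) := by
      rw [div_le_iff₀ (by linarith)]
      have : 0 ≤ U ^ a / a := by positivity
      nlinarith
    calc _ ≤ 2 + 2 * (U ^ a / a) := by linarith
      _ ≤ 2 * U ^ a + 2 * (U ^ a / a) := by linarith
      _ = _ := by ring

set_option maxHeartbeats 1600000 in
/-- Lemma 8: covering number bound for truncated interaction-model networks, expressed by
the existence of an `L_p` `ε`-cover of the asserted cardinality. -/
theorem covering_number_bound_interaction
    (d ds L r k : ℕ) (hds : 1 ≤ ds) (hdsd : ds ≤ d) (hk : 0 < k) (σ : ℝ → ℝ)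
    (hσ : ContDiff ℝ (k : ℕ∞) σ)
    (hσbdd : ∀ i ≤ k, ∃ M : ℝ, ∀ x, |iteratedDeriv i σ x| ≤ M) :
    ∃ c19 c20 c21 : ℝ, 0 < c19 ∧ 0 < c20 ∧ 0 < c21 ∧
      ∀ (K : ℕ) (α β A B C p ε : ℝ), 1 ≤ α → 0 < β → 1 ≤ A → 1 ≤ B → 1 ≤ C →
        1 ≤ p → 0 < ε → ε < β →
        ∀ (n : ℕ) (xs : Fin n → Fin d → ℝ),
          (∀ (s : Fin n) (j : Fin d), |xs s j| ≤ α) →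
          ∃ (N : ℕ) (g : Fin N → (Fin d → ℝ) → ℝ),
            IsLpCover p ε
              {f : (Fin d → ℝ) → ℝ |
                ∃ w : {S : Finset (Fin d) // S.card = ds} → NNIdx K L r ds → ℝ,
                  (∀ S, ∑ j : Fin K, |w S (NNIdx.out j)| ≤ C) ∧
                  (∀ S (kk : Fin K) (i : Fin r) (l : Fin (L - 1)) (j : Fin r),
                    |w S (NNIdx.inner l kk i j.succ)| ≤ B) ∧
                  (∀ S (kk : Fin K) (i : Fin r) (j : Fin ds),
                    |w S (NNIdx.input kk i j.succ)| ≤ A) ∧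
                  f = fun x => trunc β (fnetInter σ K L r d ds w x)}
              xs g ∧
            (N : ℝ) ≤ (c19 * β ^ p / ε ^ p)
              ^ (c20 * α ^ ds * A ^ ds * B ^ ((L - 1) * ds) * (C / ε) ^ ((ds : ℝ) / (k : ℝ))
                  + c21) := by
  obtain ⟨T, hT, hmain⟩ := kt_main ds k hk
  have hσ' : ContDiff ℝ k σ := by exact_mod_cast hσ
  obtain ⟨c, hc, hnet⟩ := kt_fnet σ k L r ds hσ' hσbdd
  obtain ⟨s, hs⟩ : ∃ s : ℕ, s = Fintype.card {S : Finset (Fin d) // S.card = ds} := ⟨_, rfl⟩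
  have hk0 : (0:ℝ) < k := by exact_mod_cast hk
  have hds0 : (0:ℝ) < ds := by exact_mod_cast hds
  obtain ⟨a, ha⟩ : ∃ a : ℝ, a = (ds : ℝ) / k := ⟨_, rfl⟩
  have ha0 : 0 < a := by rw [ha]; positivity
  obtain ⟨Q, hQ⟩ : ∃ Q : ℝ, Q = c * ((s + 1) * (2 + k)) := ⟨_, rfl⟩
  have hc0 : 0 < c := by linarith
  have hQ0 : 0 < Q := by rw [hQ]; positivity
  refine ⟨T, s * ((2 + 2 / a) * Q ^ a + 3 ^ ds * c ^ ds * Q ^ a) + 1, 1, by exact_mod_cast hT,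
    by positivity, one_pos, ?_⟩
  intro K α β A B C p ε hα hβ hA hB hC hp hε hεβ n xs hxs
  rw [← ha]
  let W := {w : {S : Finset (Fin d) // S.card = ds} → NNIdx K L r ds → ℝ //
    (∀ S, ∑ j : Fin K, |w S (NNIdx.out j)| ≤ C) ∧
    (∀ S (kk : Fin K) (i : Fin r) (l : Fin (L - 1)) (j : Fin r),
      |w S (NNIdx.inner l kk i j.succ)| ≤ B) ∧
    (∀ S (kk : Fin K) (i : Fin r) (j : Fin ds), |w S (NNIdx.input kk i j.succ)| ≤ A)}
  let F : W → (Fin d → ℝ) → ℝ := fun w x => trunc β (fnetInter σ K L r d ds w.1 x)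
  have hset : {f : (Fin d → ℝ) → ℝ |
                ∃ w : {S : Finset (Fin d) // S.card = ds} → NNIdx K L r ds → ℝ,
                  (∀ S, ∑ j : Fin K, |w S (NNIdx.out j)| ≤ C) ∧
                  (∀ S (kk : Fin K) (i : Fin r) (l : Fin (L - 1)) (j : Fin r),
                    |w S (NNIdx.inner l kk i j.succ)| ≤ B) ∧
                  (∀ S (kk : Fin K) (i : Fin r) (j : Fin ds),
                    |w S (NNIdx.input kk i j.succ)| ≤ A) ∧
                  f = fun x => trunc β (fnetInter σ K L r d ds w x)} = Set.range F := by
    ext f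
    constructor
    · rintro ⟨w, h1, h2, h3, rfl⟩
      exact ⟨⟨w, h1, h2, h3⟩, rfl⟩
    · rintro ⟨⟨w, h1, h2, h3⟩, rfl⟩
      exact ⟨w, h1, h2, h3, rfl⟩
  rw [hset]
  have hnet' : ∀ (w : W) S, ContDiff ℝ k (fnet σ K L r ds (w.1 S)) ∧
        ∀ n ≤ k, ∀ x, ‖iteratedFDeriv ℝ n (fnet σ K L r ds (w.1 S)) x‖ ≤
          C * c * (c * A * B ^ (L - 1)) ^ n := fun w S =>
    hnet K A B C hA hB hC (w.1 S) (w.2.1 S) (w.2.2.1 S) (w.2.2.2 S)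
  obtain ⟨e, he⟩ : ∃ e : ℝ, e = ε / ((s + 1) * (2 + k)) := ⟨_, rfl⟩
  have he0 : 0 < e := by rw [he]; positivity
  have hee : (s + 1) * ((2 + k) * e) = ε := by rw [he]; field_simp
  have hse : s * ((2 + k) * e) < ε := by
    rw [← hee]; have : 0 < (2 + k) * e := by positivity
    linarith
  -- reduction of the distance to the summands
  have hsum : ∀ w w' : W, (∀ S s', |fnet σ K L r ds (w.1 S) (coordRestrict d ds S (xs s')) -
      fnet σ K L r ds (w'.1 S) (coordRestrict d ds S (xs s'))| ≤ (2 + k) * e) →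
      ∀ s', |F w (xs s') - F w' (xs s')| ≤ s * ((2 + k) * e) := by
    intro w w' h s'
    refine (kt_trunc _ _ _).trans ?_
    simp only [fnetInter]
    rw [← Finset.sum_sub_distrib]
    refine (Finset.abs_sum_le_sum_abs _ _).trans
      ((Finset.sum_le_sum fun S _ => h S s').trans ?_)
    simp [hs]
  obtain ⟨U, hU⟩ : ∃ U : ℝ, U = C * c / e := ⟨_, rfl⟩
  have hU0 : 0 < U := by rw [hU]; positivity
  have hUe : U * e = C * c := by rw [hU]; field_simp
  have hUQ : U = (C / ε) * Q := by rw [hU, he, hQ]; field_simp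
  have hpos : 0 ≤ (s * ((2 + 2 / a) * Q ^ a + 3 ^ ds * c ^ ds * Q ^ a) + 1) * α ^ ds * A ^ ds *
      B ^ ((L - 1) * ds) * (C / ε) ^ a + 1 := by positivity
  by_cases hU1 : U < 1
  · obtain ⟨g, hg⟩ := kt_cover_of_code F (fun _ => ()) xs p ε (s * ((2 + k) * e)) hp
      (by positivity) hse (by
        intro w w' _
        apply hsum
        intro S s'
        have h1 := (hnet' w S).2 0 (Nat.zero_le _) (coordRestrict d ds S (xs s'))
        have h2 := (hnet' w' S).2 0 (Nat.zero_le _) (coordRestrict d ds S (xs s'))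
        simp only [norm_iteratedFDeriv_zero, pow_zero, mul_one, Real.norm_eq_abs] at h1 h2
        refine (abs_sub _ _).trans ?_
        have : C * c ≤ e := by rw [← hUe]; nlinarith
        nlinarith)
    refine ⟨_, g, hg, ?_⟩
    have := kt_count T 0 hT β p ε _ hε hεβ hp (by simpa using hpos)
    simpa using this
  · push Not at hU1
    obtain ⟨j, hj1, hj2⟩ := kt_depth U a hU1 ha0
    obtain ⟨R, hR⟩ : ∃ R : ℝ, R = c * A * B ^ (L - 1) := ⟨_, rfl⟩
    rw [← hR] at hnet'
    have hR1 : 1 ≤ R := by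
      rw [hR]
      exact one_le_mul_of_one_le_of_one_le (one_le_mul_of_one_le_of_one_le hc hA)
        (one_le_pow₀ hB)
    have hR0 : 0 < R := by linarith
    obtain ⟨Y, hY⟩ : ∃ Y : ℝ, Y = U ^ ((k:ℝ)⁻¹) := ⟨_, rfl⟩
    have hY1 : 1 ≤ Y := by rw [hY]; exact Real.one_le_rpow hU1 (by positivity)
    have hY0 : 0 < Y := by linarith
    have hYk : Y ^ k = U := by rw [hY]; exact Real.rpow_inv_natCast_pow hU0.le hk.ne'
    have hYds : Y ^ ds = U ^ a := by
      rw [hY, ← Real.rpow_natCast, ← Real.rpow_mul hU0.le, ha]; congr 1; field_simp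
    obtain ⟨lam, hlam⟩ : ∃ lam : ℝ, lam = 1 / (R * Y) := ⟨_, rfl⟩
    have hlam0 : 0 < lam := by rw [hlam]; positivity
    have hRl : lam * R = 1 / Y := by rw [hlam]; field_simp
    have hmul : ∀ m : ℕ, lam ^ m * (C * c * R ^ m) = C * c * (1 / Y) ^ m := by
      intro m; rw [← hRl, mul_pow]; ring
    let H : Set ((Fin ds → ℝ) → ℝ) := {f | ContDiff ℝ k f ∧
      ∀ n ≤ k, ∀ x, ‖iteratedFDeriv ℝ n f x‖ ≤ C * c * R ^ n}
    obtain ⟨m, hm⟩ : ∃ m : ℕ, m = ⌊2 * α / lam⌋₊ := ⟨_, rfl⟩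
    have hm1 : 2 * α < lam * (m + 1) := by
      have := Nat.lt_floor_add_one (2 * α / lam)
      rw [← hm, div_lt_iff₀ hlam0] at this
      linarith
    have hm2 : (m + 1 : ℝ) ≤ 3 * α * (R * Y) := by
      have h1 : (m : ℝ) ≤ 2 * α / lam := by rw [hm]; exact Nat.floor_le (by positivity)
      have h2 : 2 * α / lam = 2 * α * (R * Y) := by rw [hlam]; field_simp
      have h3 : 1 ≤ α * (R * Y) := one_le_mul_of_one_le_of_one_le hα
        (one_le_mul_of_one_le_of_one_le hR1 hY1)
      linarith
    obtain ⟨code, hcode⟩ := hmain lam e (C * c) hlam0 he0 H (fun f hf => hf.1) (by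
        intro f hf x
        calc _ ≤ lam ^ k * (C * c * R ^ k) := by gcongr; exact hf.2 k le_rfl x
          _ = e := by
            rw [hmul, one_div, inv_pow, hYk, ← hUe]; field_simp
          _ ≤ e := le_rfl) (by
        intro f hf i hi x
        calc _ ≤ lam ^ i * (C * c * R ^ i) := by gcongr; exact hf.2 i hi.le x
          _ = C * c * (1 / Y) ^ i := hmul i
          _ ≤ C * c * 1 := by
            gcongr
            exact pow_le_one₀ (by positivity) (by rw [div_le_one hY0]; exact hY1)
          _ = _ := by ring) j m (-α) (by rw [← hUe, ← mul_assoc]; gcongr)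
    obtain ⟨g, hg⟩ := kt_cover_of_code F
      (fun w S => code ⟨fnet σ K L r ds (w.1 S), hnet' w S⟩) xs p ε (s * ((2 + k) * e)) hp
      (by positivity) hse (by
        intro w w' hww
        apply hsum
        intro S s'
        refine hcode _ _ (congrFun hww S) _ ?_
        intro i
        have := abs_le.1 (hxs s' (S.1.orderIsoOfFin S.2 i))
        simp only [coordRestrict]
        constructor
        · exact this.1
        · linarith [this.2])
    refine ⟨_, g, hg, ?_⟩
    have hcard : Fintype.card ({S : Finset (Fin d) // S.card = ds} →
        Fin (T ^ (j + (m + 1) ^ ds))) = T ^ ((j + (m + 1) ^ ds) * s) := by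
      rw [Fintype.card_fun, Fintype.card_fin, ← hs, ← pow_mul]
    rw [hcard]
    refine kt_count T _ hT β p ε _ hε hεβ hp ?_
    have hUa : U ^ a = (C / ε) ^ a * Q ^ a := by
      rw [hUQ, Real.mul_rpow (by positivity) hQ0.le]
    have hm3 : ((m : ℝ) + 1) ^ ds ≤ 3 ^ ds * α ^ ds * (c ^ ds * A ^ ds * B ^ ((L - 1) * ds)) *
        ((C / ε) ^ a * Q ^ a) := by
      calc _ ≤ (3 * α * (R * Y)) ^ ds := by gcongr
        _ = 3 ^ ds * α ^ ds * R ^ ds * Y ^ ds := by ring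
        _ = _ := by rw [hYds, hUa, hR, mul_pow (c * A), mul_pow c, ← pow_mul]
    obtain ⟨Z, hZ⟩ : ∃ Z : ℝ, Z = α ^ ds * A ^ ds * B ^ ((L - 1) * ds) := ⟨_, rfl⟩
    have hZ1 : 1 ≤ Z := by
      rw [hZ]
      exact one_le_mul_of_one_le_of_one_le
        (one_le_mul_of_one_le_of_one_le (one_le_pow₀ hα) (one_le_pow₀ hA)) (one_le_pow₀ hB)
    obtain ⟨X, hX⟩ : ∃ X : ℝ, X = (C / ε) ^ a := ⟨_, rfl⟩
    have hX0 : 0 < X := by rw [hX]; positivity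
    have hqa : 0 < Q ^ a := by positivity
    have hj3 : (j : ℝ) ≤ (2 + 2 / a) * Q ^ a * (Z * X) := by
      calc _ ≤ (2 + 2 / a) * U ^ a := hj2
        _ = (2 + 2 / a) * Q ^ a * (1 * X) := by rw [hUa, hX]; ring
        _ ≤ _ := by gcongr
    have hm4 : ((m : ℝ) + 1) ^ ds ≤ 3 ^ ds * c ^ ds * Q ^ a * (Z * X) := by
      refine hm3.trans (le_of_eq ?_)
      rw [hZ, hX]; ring
    push_cast
    calc ((j : ℝ) + (m + 1) ^ ds) * s ≤
        ((2 + 2 / a) * Q ^ a * (Z * X) + 3 ^ ds * c ^ ds * Q ^ a * (Z * X)) * s := by gcongr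
      _ ≤ (s * ((2 + 2 / a) * Q ^ a + 3 ^ ds * c ^ ds * Q ^ a) + 1) * (Z * X) + 1 := by
        have : 0 < Z * X := by positivity
        nlinarith
      _ = _ := by rw [hZ, hX]; ring
end

section
/- Lipschitz bound on the weight-gradient of the network in the weights (intermediate claim in the proof of Lemma 3): let σ : ℝ → ℝ be bounded and differentiable with a Lipschitz continuous and bounded derivative. Let α_n ≥ 1, γ_n* ≥ 1, B_n ≥ 1, and let w₁, w₂ be weight vectors with max{|(w₁)^{(L)}_{1,1,k}|, |(w₂)^{(L)}_{1,1,k}|} ≤ γ_n* for k = 1,…,K_n and max{|(w₁)^{(l)}_{k,i,j}|, |(w₂)^{(l)}_{k,i,j}|} ≤ B_n for l = 1,…,L−1. Then there is a constant c₂₃ (depending only on d, L, r and σ) such that for all X_1,…,X_n ∈ [−α_n, α_n]^d: Σ_{k,i,j,l} max_{s = 1,…,n} ( ∂f_{w₁}/∂w^{(l)}_{k,i,j}(X_s) − ∂f_{w₂}/∂w^{(l)}_{k,i,j}(X_s) )² ≤ c₂₃·K_n·B_n^{4L}·α_n^4·(γ_n*)²·‖w₁ − w₂‖², where the sum runs over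 all components (k,i,j,l) of the weight vector. -/
open scoped BigOperators

/-- The partial derivative `∂f_w/∂w_idx (x)` of the network output with respect to the
single weight component `idx` of the weight vector. -/
noncomputable def dNet (σ : ℝ → ℝ) (K L r d : ℕ) (w : NNIdx K L r d → ℝ)
    (idx : NNIdx K L r d) (x : Fin d → ℝ) : ℝ :=
  deriv (fun t => fnet σ K L r d (Function.update w idx t) x) (w idx)

/-- The block (sub-network) an index belongs to. -/
def nblk {K L r d : ℕ} : NNIdx K L r d → Fin K
  | .out k => k
  | .inner _ k _ _ => k
  | .input k _ _ => k

lemma nOut_bdd (σ : ℝ → ℝ) (M : ℝ) (hM : 0 ≤ M) (hσ : ∀ x, |σ x| ≤ M) (K L r d : ℕ)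
    (w : NNIdx K L r d → ℝ) (k : Fin K) (l : ℕ) (i : Fin r) (x : Fin d → ℝ) :
    |nOut σ K L r d w k l i x| ≤ M := by
  match l with
  | 0 => simpa [nOut] using hM
  | 1 => simpa [nOut] using hσ _
  | l + 2 =>
    rw [nOut]
    split_ifs
    · exact hσ _
    · simpa using hM

lemma nOut_update (σ : ℝ → ℝ) (K L r d : ℕ)
    (w : NNIdx K L r d → ℝ) (idx : NNIdx K L r d) (t : ℝ) (k : Fin K) (hk : nblk idx ≠ k)
    (x : Fin d → ℝ) (l : ℕ) : ∀ i : Fin r,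
    nOut σ K L r d (Function.update w idx t) k l i x = nOut σ K L r d w k l i x := by
  induction l using Nat.strong_induction_on with
  | _ l ih =>
  intro i
  match l with
  | 0 => simp [nOut]
  | 1 =>
    have h : ∀ j, Function.update w idx t (NNIdx.input k i j) = w (NNIdx.input k i j) := by
      intro j
      apply Function.update_of_ne
      rintro rfl
      exact hk rfl
    simp [nOut, h]
  | l + 2 =>
    have h : ∀ l' j, Function.update w idx t (NNIdx.inner l' k i j) = w (NNIdx.inner l' k i j) := by
      intro l' j
      apply Function.update_of_ne
      rintro rfl
      exact hk rfl
    simp only [nOut, h, ih (l + 1) (by omega)]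

lemma sigma_step (σ : ℝ → ℝ) (M : ℝ) (hM : 0 ≤ M) (hσdiff : Differentiable ℝ σ)
    (h1 : ∀ x, |deriv σ x| ≤ M) (h2 : ∀ x y : ℝ, |deriv σ x - deriv σ y| ≤ M * |x - y|)
    (z1 z2 : ℝ → ℝ) (t1 t2 A1 A2 a b c : ℝ)
    (hz1 : HasDerivAt z1 A1 t1) (hz2 : HasDerivAt z2 A2 t2)
    (hA1 : |A1| ≤ a) (hA2 : |A2| ≤ a) (hb : |z1 t1 - z2 t2| ≤ b) (hc : |A1 - A2| ≤ c) :
    ∃ D1 D2, HasDerivAt (fun t => σ (z1 t)) D1 t1 ∧ HasDerivAt (fun t => σ (z2 t)) D2 t2 ∧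
      |D1| ≤ M * a ∧ |D2| ≤ M * a ∧ |σ (z1 t1) - σ (z2 t2)| ≤ M * b ∧
      |D1 - D2| ≤ M * b * a + M * c := by
  have ha : 0 ≤ a := (abs_nonneg _).trans hA1
  refine ⟨deriv σ (z1 t1) * A1, deriv σ (z2 t2) * A2,
    (hσdiff (z1 t1)).hasDerivAt.comp t1 hz1, (hσdiff (z2 t2)).hasDerivAt.comp t2 hz2, ?_, ?_, ?_, ?_⟩
  · rw [abs_mul]; exact mul_le_mul (h1 _) hA1 (abs_nonneg _) hM
  · rw [abs_mul]; exact mul_le_mul (h1 _) hA2 (abs_nonneg _) hM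
  · have := Convex.norm_image_sub_le_of_norm_deriv_le (f := σ) (s := Set.univ) (C := M)
      (x := z2 t2) (y := z1 t1)
      (fun x _ => hσdiff x) (fun x _ => h1 x) convex_univ (Set.mem_univ _) (Set.mem_univ _)
    simp only [Real.norm_eq_abs] at this
    exact this.trans (mul_le_mul_of_nonneg_left hb hM)
  · have e : deriv σ (z1 t1) * A1 - deriv σ (z2 t2) * A2 =
      (deriv σ (z1 t1) - deriv σ (z2 t2)) * A1 + deriv σ (z2 t2) * (A1 - A2) := by ring
    rw [e]
    refine (abs_add_le _ _).trans ?_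
    rw [abs_mul, abs_mul]
    have h3 : |deriv σ (z1 t1) - deriv σ (z2 t2)| ≤ M * b :=
      (h2 _ _).trans (mul_le_mul_of_nonneg_left hb hM)
    exact add_le_add (mul_le_mul h3 hA1 (abs_nonneg _) ((abs_nonneg _).trans h3))
      (mul_le_mul (h1 _) hc (abs_nonneg _) hM)

lemma upd_deriv {ι : Type*} [DecidableEq ι] (w : ι → ℝ) (idx : ι) (a : ι) :
    HasDerivAt (fun t => Function.update w idx t a) (if a = idx then 1 else 0) (w idx) := by
  by_cases h : a = idx
  · subst h
    simpa using hasDerivAt_id' (w a)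
  · simpa [h] using hasDerivAt_const (w idx) (w a)

/-- The inductive bound at level `m + 1`. -/
def LayerB (σ : ℝ → ℝ) (d L r m : ℕ) (C : ℝ) : Prop :=
  ∀ (K : ℕ) (α B δ : ℝ), 1 ≤ α → 1 ≤ B → 0 ≤ δ → ∀ w1 w2 : NNIdx K L r d → ℝ,
    (∀ l k i j, |w1 (NNIdx.inner l k i j)| ≤ B) → (∀ l k i j, |w2 (NNIdx.inner l k i j)| ≤ B) →
    (∀ a, |w1 a - w2 a| ≤ δ) → ∀ x : Fin d → ℝ, (∀ j, |x j| ≤ α) →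
    ∀ (k : Fin K) (idx : NNIdx K L r d) (i : Fin r), ∃ D1 D2,
      HasDerivAt (fun t => nOut σ K L r d (Function.update w1 idx t) k (m + 1) i x) D1 (w1 idx) ∧
      HasDerivAt (fun t => nOut σ K L r d (Function.update w2 idx t) k (m + 1) i x) D2 (w2 idx) ∧
      |D1| ≤ C * (B ^ m * α) ∧ |D2| ≤ C * (B ^ m * α) ∧
      |nOut σ K L r d w1 k (m + 1) i x - nOut σ K L r d w2 k (m + 1) i x| ≤ C * (B ^ m * α) * δ ∧
      |D1 - D2| ≤ C * (B ^ m * α) ^ 2 * δ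

lemma sum_abs_le {p : ℕ} (f : Fin p → ℝ) (c : ℝ) (h : ∀ j, |f j| ≤ c) : |∑ j, f j| ≤ p * c := by
  refine (Finset.abs_sum_le_sum_abs _ _).trans ?_
  refine (Finset.sum_le_sum (fun j _ => h j)).trans ?_
  simp

lemma ite_abs (p : Prop) [Decidable p] : |(if p then (1:ℝ) else 0)| ≤ 1 := by
  split_ifs <;> simp

lemma layer_zero (σ : ℝ → ℝ) (d L r : ℕ) (M : ℝ) (hM : 1 ≤ M) (hσdiff : Differentiable ℝ σ)
    (h1 : ∀ x, |deriv σ x| ≤ M) (h2 : ∀ x y : ℝ, |deriv σ x - deriv σ y| ≤ M * |x - y|) :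
    ∃ C, 0 ≤ C ∧ LayerB σ d L r 0 C := by
  have hM0 : 0 ≤ M := by linarith
  refine ⟨M * (d + 1) ^ 2, by positivity, ?_⟩
  intro K α B δ hα hB hδ w1 w2 hw1 hw2 hw x hx k idx i
  have hz : ∀ w : NNIdx K L r d → ℝ, HasDerivAt
      (fun t => (∑ j : Fin d, Function.update w idx t (NNIdx.input k i j.succ) * x j) +
        Function.update w idx t (NNIdx.input k i 0))
      ((∑ j : Fin d, (if NNIdx.input k i j.succ = idx then (1:ℝ) else 0) * x j) +
        (if NNIdx.input k i 0 = idx then (1:ℝ) else 0)) (w idx) := by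
    intro w
    refine HasDerivAt.add (HasDerivAt.fun_sum fun j _ => ?_) (upd_deriv _ _ _)
    exact (upd_deriv _ _ _).mul_const _
  have hA : |(∑ j : Fin d, (if NNIdx.input k i j.succ = idx then (1:ℝ) else 0) * x j) +
        (if NNIdx.input k i 0 = idx then (1:ℝ) else 0)| ≤ (d + 1) * α := by
    refine (abs_add_le _ _).trans ?_
    have := sum_abs_le (fun j : Fin d => (if NNIdx.input k i j.succ = idx then (1:ℝ) else 0) * x j) α
      (fun j => by
        rw [abs_mul]
        calc _ ≤ 1 * α := mul_le_mul (ite_abs _) (hx j) (abs_nonneg _) (by norm_num)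
          _ = α := one_mul _)
    have h3 := ite_abs (NNIdx.input k i 0 = idx)
    linarith
  have hb : |((∑ j : Fin d, w1 (NNIdx.input k i j.succ) * x j) + w1 (NNIdx.input k i 0)) -
      ((∑ j : Fin d, w2 (NNIdx.input k i j.succ) * x j) + w2 (NNIdx.input k i 0))|
      ≤ (d + 1) * α * δ := by
    rw [add_sub_add_comm, ← Finset.sum_sub_distrib]
    refine (abs_add_le _ _).trans ?_
    have := sum_abs_le (fun j : Fin d => w1 (NNIdx.input k i j.succ) * x j -
        w2 (NNIdx.input k i j.succ) * x j) (δ * α)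
      (fun j => by
        rw [← sub_mul, abs_mul]
        exact mul_le_mul (hw _) (hx j) (abs_nonneg _) hδ)
    have h3 := hw (NNIdx.input k i 0)
    nlinarith
  obtain ⟨D1, D2, e1, e2, e3, e4, e5, e6⟩ := sigma_step σ M hM0 hσdiff h1 h2 _ _ _ _ _ _
    ((d + 1) * α) ((d + 1) * α * δ) 0 (hz w1) (hz w2) hA hA (by simpa using hb) (by simp)
  simp only [Function.update_eq_self] at e5
  have hd : (1:ℝ) ≤ d + 1 := by have : (0:ℝ) ≤ d := Nat.cast_nonneg d
                                linarith
  have hdd : ((d:ℝ) + 1) ≤ (d + 1) ^ 2 := by nlinarith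
  have key : M * ((d + 1) * α) ≤ M * (d + 1) ^ 2 * (B ^ 0 * α) := by
    have : ((d:ℝ) + 1) * α ≤ (d + 1) ^ 2 * α := mul_le_mul_of_nonneg_right hdd (by linarith)
    have := mul_le_mul_of_nonneg_left this hM0
    simpa [mul_assoc] using this
  refine ⟨D1, D2, by simpa [nOut] using e1, by simpa [nOut] using e2, e3.trans key, e4.trans key,
    ?_, ?_⟩
  · simp only [zero_add, nOut]
    refine e5.trans ?_
    rw [← mul_assoc]
    exact mul_le_mul_of_nonneg_right key hδ
  · refine e6.trans (le_of_eq ?_)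
    ring

lemma layer_succ (σ : ℝ → ℝ) (d L r : ℕ) (M : ℝ) (hM : 1 ≤ M) (hσ : ∀ x, |σ x| ≤ M)
    (hσdiff : Differentiable ℝ σ)
    (h1 : ∀ x, |deriv σ x| ≤ M) (h2 : ∀ x y : ℝ, |deriv σ x - deriv σ y| ≤ M * |x - y|)
    (m : ℕ) (C : ℝ) (hC : 0 ≤ C) (hm : LayerB σ d L r m C) :
    ∃ C, 0 ≤ C ∧ LayerB σ d L r (m + 1) C := by
  have hM0 : 0 ≤ M := by linarith
  obtain ⟨c, hc⟩ : ∃ c : ℝ, c = r * (M + C) + 1 := ⟨_, rfl⟩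
  have hc1 : 1 ≤ c := by
    have : 0 ≤ (r:ℝ) * (M + C) := by positivity
    linarith
  have hC' : M * c ≤ M * c ^ 2 + M * (r * (3 * C)) := by
    have : M * c ≤ M * c ^ 2 := mul_le_mul_of_nonneg_left (by nlinarith) hM0
    have : 0 ≤ M * (r * (3 * C)) := by positivity
    linarith
  refine ⟨M * c ^ 2 + M * (r * (3 * C)), by positivity, ?_⟩
  intro K α B δ hα hB hδ w1 w2 hw1 hw2 hw x hx k idx i
  by_cases hl : m < L - 1
  swap
  · refine ⟨0, 0, ?_, ?_, ?_, ?_, ?_, ?_⟩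
    · simpa [nOut, hl] using hasDerivAt_const _ _
    · simpa [nOut, hl] using hasDerivAt_const _ _
    · simp; positivity
    · simp; positivity
    · simp [nOut, hl]; positivity
    · simp; positivity
  choose D1 D2 f1 f2 f3 f4 f5 f6 using hm K α B δ hα hB hδ w1 w2 hw1 hw2 hw x hx k idx
  obtain ⟨T, hT⟩ : ∃ T, T = B ^ m * α := ⟨_, rfl⟩
  have hT1 : 1 ≤ T := hT ▸ one_le_mul_of_one_le_of_one_le (one_le_pow₀ hB) hα
  rw [← hT] at f3 f4 f5 f6
  have hTs : B ^ (m + 1) * α = B * T := by rw [hT]; ring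
  rw [hTs]
  have hBT : 1 ≤ B * T := one_le_mul_of_one_le_of_one_le hB hT1
  have hz : ∀ (w : NNIdx K L r d → ℝ) (D : Fin r → ℝ),
      (∀ i, HasDerivAt (fun t => nOut σ K L r d (Function.update w idx t) k (m + 1) i x) (D i)
        (w idx)) → HasDerivAt
      (fun t => (∑ j : Fin r, Function.update w idx t (NNIdx.inner ⟨m, hl⟩ k i j.succ) *
          nOut σ K L r d (Function.update w idx t) k (m + 1) j x) +
        Function.update w idx t (NNIdx.inner ⟨m, hl⟩ k i 0))
      ((∑ j : Fin r, ((if NNIdx.inner ⟨m, hl⟩ k i j.succ = idx then (1:ℝ) else 0) *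
          nOut σ K L r d w k (m + 1) j x + w (NNIdx.inner ⟨m, hl⟩ k i j.succ) * D j)) +
        (if NNIdx.inner ⟨m, hl⟩ k i 0 = idx then (1:ℝ) else 0)) (w idx) := by
    intro w D hD
    refine HasDerivAt.add (HasDerivAt.fun_sum fun j _ => ?_) (upd_deriv _ _ _)
    have := (upd_deriv w idx (NNIdx.inner ⟨m, hl⟩ k i j.succ)).mul (hD j)
    simp only [Function.update_eq_self] at this
    exact this
  have hA : ∀ (w : NNIdx K L r d → ℝ) (D : Fin r → ℝ),
      (∀ l k i j, |w (NNIdx.inner l k i j)| ≤ B) → (∀ i, |D i| ≤ C * T) →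
      |(∑ j : Fin r, ((if NNIdx.inner ⟨m, hl⟩ k i j.succ = idx then (1:ℝ) else 0) *
          nOut σ K L r d w k (m + 1) j x + w (NNIdx.inner ⟨m, hl⟩ k i j.succ) * D j)) +
        (if NNIdx.inner ⟨m, hl⟩ k i 0 = idx then (1:ℝ) else 0)| ≤ c * (B * T) := by
    intro w D hwB hD
    refine (abs_add_le _ _).trans ?_
    have := sum_abs_le (fun j : Fin r =>
      (if NNIdx.inner ⟨m, hl⟩ k i j.succ = idx then (1:ℝ) else 0) *
          nOut σ K L r d w k (m + 1) j x + w (NNIdx.inner ⟨m, hl⟩ k i j.succ) * D j)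
      ((M + C) * (B * T))
      (fun j => by
        refine (abs_add_le _ _).trans ?_
        rw [abs_mul, abs_mul]
        have g1 := mul_le_mul (ite_abs (NNIdx.inner ⟨m, hl⟩ k i j.succ = idx))
          (nOut_bdd σ M hM0 hσ K L r d w k (m + 1) j x) (abs_nonneg _) (by norm_num)
        have g2 := mul_le_mul (hwB ⟨m, hl⟩ k i j.succ) (hD j) (abs_nonneg _) (by linarith)
        have g3 : M * 1 ≤ M * (B * T) := mul_le_mul_of_nonneg_left hBT hM0
        linarith)
    have h3 := ite_abs (NNIdx.inner ⟨m, hl⟩ k i 0 = idx)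
    rw [hc]
    linarith
  have hb : |((∑ j : Fin r, w1 (NNIdx.inner ⟨m, hl⟩ k i j.succ) *
        nOut σ K L r d w1 k (m + 1) j x) + w1 (NNIdx.inner ⟨m, hl⟩ k i 0)) -
      ((∑ j : Fin r, w2 (NNIdx.inner ⟨m, hl⟩ k i j.succ) *
        nOut σ K L r d w2 k (m + 1) j x) + w2 (NNIdx.inner ⟨m, hl⟩ k i 0))|
      ≤ c * (B * T) * δ := by
    rw [add_sub_add_comm, ← Finset.sum_sub_distrib]
    refine (abs_add_le _ _).trans ?_
    have := sum_abs_le (fun j : Fin r => w1 (NNIdx.inner ⟨m, hl⟩ k i j.succ) *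
        nOut σ K L r d w1 k (m + 1) j x - w2 (NNIdx.inner ⟨m, hl⟩ k i j.succ) *
        nOut σ K L r d w2 k (m + 1) j x) ((M + C) * (B * T) * δ)
      (fun j => by
        have e : w1 (NNIdx.inner ⟨m, hl⟩ k i j.succ) *
          nOut σ K L r d w1 k (m + 1) j x - w2 (NNIdx.inner ⟨m, hl⟩ k i j.succ) *
          nOut σ K L r d w2 k (m + 1) j x =
          (w1 (NNIdx.inner ⟨m, hl⟩ k i j.succ) - w2 (NNIdx.inner ⟨m, hl⟩ k i j.succ)) *
            nOut σ K L r d w1 k (m + 1) j x + w2 (NNIdx.inner ⟨m, hl⟩ k i j.succ) *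
          (nOut σ K L r d w1 k (m + 1) j x - nOut σ K L r d w2 k (m + 1) j x) := by ring
        rw [e]
        refine (abs_add_le _ _).trans ?_
        rw [abs_mul, abs_mul]
        have g1 := mul_le_mul (hw (NNIdx.inner ⟨m, hl⟩ k i j.succ))
          (nOut_bdd σ M hM0 hσ K L r d w1 k (m + 1) j x) (abs_nonneg _) hδ
        have g2 := mul_le_mul (hw2 ⟨m, hl⟩ k i j.succ) (f5 j) (abs_nonneg _) (by linarith)
        have g3 : (δ * M) * 1 ≤ (δ * M) * (B * T) := mul_le_mul_of_nonneg_left hBT (by positivity)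
        linarith)
    have h3 := hw (NNIdx.inner ⟨m, hl⟩ k i 0)
    have h4 : δ * 1 ≤ δ * (B * T) := mul_le_mul_of_nonneg_left hBT hδ
    rw [hc]
    linarith
  have hcc : |((∑ j : Fin r, ((if NNIdx.inner ⟨m, hl⟩ k i j.succ = idx then (1:ℝ) else 0) *
          nOut σ K L r d w1 k (m + 1) j x + w1 (NNIdx.inner ⟨m, hl⟩ k i j.succ) * D1 j)) +
        (if NNIdx.inner ⟨m, hl⟩ k i 0 = idx then (1:ℝ) else 0)) -
      ((∑ j : Fin r, ((if NNIdx.inner ⟨m, hl⟩ k i j.succ = idx then (1:ℝ) else 0) *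
          nOut σ K L r d w2 k (m + 1) j x + w2 (NNIdx.inner ⟨m, hl⟩ k i j.succ) * D2 j)) +
        (if NNIdx.inner ⟨m, hl⟩ k i 0 = idx then (1:ℝ) else 0))|
      ≤ r * (3 * C * (B * T) ^ 2 * δ) := by
    rw [add_sub_add_right_eq_sub, ← Finset.sum_sub_distrib]
    refine sum_abs_le _ _ (fun j => ?_)
    have e : ∀ e o1 o2 u1 u2 d1 d2 : ℝ, (e * o1 + u1 * d1) - (e * o2 + u2 * d2) =
      e * (o1 - o2) + (u1 - u2) * d1 + u2 * (d1 - d2) := by intros; ring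
    rw [e]
    refine (abs_add_three _ _ _).trans ?_
    rw [abs_mul, abs_mul, abs_mul]
    have g1 := mul_le_mul (ite_abs (NNIdx.inner ⟨m, hl⟩ k i j.succ = idx))
          (f5 j) (abs_nonneg _) (by norm_num)
    have g2 := mul_le_mul (hw (NNIdx.inner ⟨m, hl⟩ k i j.succ)) (f3 j) (abs_nonneg _) hδ
    have g3 := mul_le_mul (hw2 ⟨m, hl⟩ k i j.succ) (f6 j) (abs_nonneg _) (by linarith)
    have k1 : T ≤ (B * T) ^ 2 := by
      have : T ≤ B * T := le_mul_of_one_le_left (by linarith) hB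
      nlinarith
    have k2 : B * T ^ 2 ≤ (B * T) ^ 2 := by
      have : 0 ≤ B * T ^ 2 := by positivity
      nlinarith
    have hCδ : 0 ≤ C * δ := by positivity
    have q1 := mul_le_mul_of_nonneg_left k1 hCδ
    have q2 := mul_le_mul_of_nonneg_left k2 hCδ
    linarith
  obtain ⟨E1, E2, e1, e2, e3, e4, e5, e6⟩ := sigma_step σ M hM0 hσdiff h1 h2 _ _ _ _ _ _
    (c * (B * T)) (c * (B * T) * δ) _ (hz w1 D1 f1) (hz w2 D2 f2) (hA w1 D1 hw1 f3)
    (hA w2 D2 hw2 f4) (by simpa only [Function.update_eq_self] using hb) hcc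
  simp only [Function.update_eq_self] at e5
  have key : M * (c * (B * T)) ≤ (M * c ^ 2 + M * (r * (3 * C))) * (B * T) := by
    rw [← mul_assoc]
    exact mul_le_mul_of_nonneg_right hC' (by linarith)
  refine ⟨E1, E2, by simpa only [nOut, hl, dite_true] using e1,
    by simpa only [nOut, hl, dite_true] using e2, e3.trans key, e4.trans key, ?_, ?_⟩
  · simp only [nOut, hl, dite_true]
    refine e5.trans ?_
    rw [← mul_assoc]
    exact mul_le_mul_of_nonneg_right key hδ
  · refine e6.trans (le_of_eq ?_)
    ring

lemma layer_all (σ : ℝ → ℝ) (d L r : ℕ) (M : ℝ) (hM : 1 ≤ M) (hσ : ∀ x, |σ x| ≤ M)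
    (hσdiff : Differentiable ℝ σ)
    (h1 : ∀ x, |deriv σ x| ≤ M) (h2 : ∀ x y : ℝ, |deriv σ x - deriv σ y| ≤ M * |x - y|)
    (m : ℕ) : ∃ C, 0 ≤ C ∧ LayerB σ d L r m C := by
  induction m with
  | zero => exact layer_zero σ d L r M hM hσdiff h1 h2
  | succ m ih =>
    obtain ⟨C, hC, h⟩ := ih
    exact layer_succ σ d L r M hM hσ hσdiff h1 h2 m C hC h

lemma fnet_deriv (σ : ℝ → ℝ) (K L r d : ℕ) (hr : 0 < r) (w : NNIdx K L r d → ℝ)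
    (idx : NNIdx K L r d) (x : Fin d → ℝ) (D : ℝ)
    (hD : HasDerivAt (fun t => nOut σ K L r d (Function.update w idx t) (nblk idx) L ⟨0, hr⟩ x) D
      (w idx)) :
    dNet σ K L r d w idx x = (if NNIdx.out (nblk idx) = idx then (1:ℝ) else 0) *
      nOut σ K L r d w (nblk idx) L ⟨0, hr⟩ x + w (NNIdx.out (nblk idx)) * D := by
  have h := (upd_deriv w idx (NNIdx.out (nblk idx))).mul hD
  simp only [Function.update_eq_self] at h
  have h' := h.add_const (∑ k ∈ Finset.univ.erase (nblk idx),
    w (NNIdx.out k) * nOut σ K L r d w k L ⟨0, hr⟩ x)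
  unfold dNet
  refine HasDerivAt.deriv (h'.congr_of_eventuallyEq (Filter.Eventually.of_forall fun t => ?_))
  simp only [fnet, hr, dite_true, Pi.mul_apply]
  rw [← Finset.add_sum_erase _ _ (Finset.mem_univ (nblk idx))]
  congr 1
  refine Finset.sum_congr rfl fun k hk => ?_
  have hk' : nblk idx ≠ k := (Finset.ne_of_mem_erase hk).symm
  rw [nOut_update σ K L r d w idx t k hk', Function.update_of_ne]
  rintro rfl
  exact hk' rfl

lemma card_idx (K L r d : ℕ) :
    Fintype.card (NNIdx K L r d) ≤ K * (1 + ((L - 1) * (r * (r + 1)) + r * (d + 1))) := by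
  let f : NNIdx K L r d → Fin K × (Unit ⊕ ((Fin (L - 1) × (Fin r × Fin (r + 1))) ⊕
      (Fin r × Fin (d + 1)))) := fun a => match a with
    | .out k => (k, .inl ())
    | .inner l k i j => (k, .inr (.inl (l, i, j)))
    | .input k i j => (k, .inr (.inr (i, j)))
  have hf : Function.Injective f := by
    intro a b h
    cases a <;> cases b <;> simp_all [f]
  simpa using Fintype.card_le_of_injective f hf


/-- Lipschitz bound on the weight-gradient of the network in the weights (intermediate
claim in the proof of Lemma 3): the constant `c₂₃` depends only on `d`, `L`, `r` and `σ`;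
`‖w₁ - w₂‖` is the Euclidean norm of the difference of the full weight vectors. -/
theorem network_gradient_lipschitz_in_weights
    (d L r : ℕ) (σ : ℝ → ℝ)
    (hσbdd : ∃ M : ℝ, ∀ x, |σ x| ≤ M)
    (hσdiff : Differentiable ℝ σ)
    (hσ'bdd : ∃ M : ℝ, ∀ x, |deriv σ x| ≤ M)
    (hσ'lip : ∃ M : ℝ, ∀ x y : ℝ, |deriv σ x - deriv σ y| ≤ M * |x - y|) :
    ∃ c23 : ℝ, 0 < c23 ∧
      ∀ (K n : ℕ) (αn γn Bn : ℝ), 1 ≤ αn → 1 ≤ γn → 1 ≤ Bn →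
        ∀ w1 w2 : EuclideanSpace ℝ (NNIdx K L r d),
          (∀ k : Fin K, max |w1 (NNIdx.out k)| |w2 (NNIdx.out k)| ≤ γn) →
          (∀ (l : Fin (L - 1)) (k : Fin K) (i : Fin r) (j : Fin (r + 1)),
            max |w1 (NNIdx.inner l k i j)| |w2 (NNIdx.inner l k i j)| ≤ Bn) →
          ∀ X : Fin n → Fin d → ℝ, (∀ (s : Fin n) (j : Fin d), |X s j| ≤ αn) →
            ∑ idx : NNIdx K L r d,
                (⨆ s : Fin n, (dNet σ K L r d w1 idx (X s) - dNet σ K L r d w2 idx (X s)) ^ 2)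
              ≤ c23 * (K : ℝ) * Bn ^ (4 * L) * αn ^ 4 * γn ^ 2 * ‖w1 - w2‖ ^ 2 := by
  obtain ⟨M0, hM0⟩ := hσbdd
  obtain ⟨M1, hM1⟩ := hσ'bdd
  obtain ⟨M2, hM2⟩ := hσ'lip
  obtain ⟨M, hM, hMa, hMb, hMc⟩ : ∃ M : ℝ, 1 ≤ M ∧ M0 ≤ M ∧ M1 ≤ M ∧ M2 ≤ M :=
    ⟨max 1 (max M0 (max M1 M2)), by simp, by simp, by simp, by simp⟩
  have h0 : ∀ x, |σ x| ≤ M := fun x => (hM0 x).trans hMa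
  have h1 : ∀ x, |deriv σ x| ≤ M := fun x => (hM1 x).trans hMb
  have h2 : ∀ x y : ℝ, |deriv σ x - deriv σ y| ≤ M * |x - y| := fun x y =>
    (hM2 x y).trans (mul_le_mul_of_nonneg_right hMc (abs_nonneg _))
  obtain ⟨C, hC, hB⟩ := layer_all σ d L r M hM h0 hσdiff h1 h2 (L - 1)
  obtain ⟨N, hN⟩ : ∃ N : ℕ, N = 1 + ((L - 1) * (r * (r + 1)) + r * (d + 1)) := ⟨_, rfl⟩
  have hN1 : (1:ℝ) ≤ N := by
    have : 1 ≤ N := by omega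
    exact_mod_cast this
  refine ⟨N * (3 * C + 1) ^ 2, by positivity, ?_⟩
  intro K n α γ B hα hγ hB1 w1 w2 hout hinn X hX
  have hcoord : ∀ idx (s : Fin n), |dNet σ K L r d w1 idx (X s) - dNet σ K L r d w2 idx (X s)| ≤
      (3 * C + 1) * (B ^ (2 * L) * α ^ 2 * γ * ‖w1 - w2‖) := by
    intro idx s
    have hR : 0 ≤ (3 * C + 1) * (B ^ (2 * L) * α ^ 2 * γ * ‖w1 - w2‖) := by positivity
    rcases Nat.eq_zero_or_pos r with hr | hr
    · simpa [dNet, fnet, hr] using hR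
    rcases Nat.eq_zero_or_pos L with hL | hL
    · subst hL
      simpa [dNet, fnet, nOut] using hR
    obtain ⟨δ, hδ⟩ : ∃ δ, δ = ‖w1 - w2‖ := ⟨_, rfl⟩
    rw [← hδ]
    have hδ0 : 0 ≤ δ := hδ ▸ norm_nonneg _
    have hw : ∀ a, |w1 a - w2 a| ≤ δ := fun a => by
      rw [hδ]; simpa using PiLp.norm_apply_le (w1 - w2) a
    obtain ⟨D1, D2, f1, f2, f3, f4, f5, f6⟩ := hB K α B δ hα hB1 hδ0 w1 w2
      (fun l k i j => (le_max_left _ _).trans (hinn l k i j))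
      (fun l k i j => (le_max_right _ _).trans (hinn l k i j)) hw (X s) (hX s)
      (nblk idx) idx ⟨0, hr⟩
    have hL1 : L - 1 + 1 = L := by omega
    rw [hL1] at f5
    simp only [hL1] at f1 f2
    rw [fnet_deriv σ K L r d hr w1 idx (X s) D1 f1, fnet_deriv σ K L r d hr w2 idx (X s) D2 f2]
    have e : ∀ e o1 o2 u1 u2 d1 d2 : ℝ, (e * o1 + u1 * d1) - (e * o2 + u2 * d2) =
      e * (o1 - o2) + (u1 - u2) * d1 + u2 * (d1 - d2) := by intros; ring
    rw [e]
    refine (abs_add_three _ _ _).trans ?_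
    rw [abs_mul, abs_mul, abs_mul]
    have g1 := mul_le_mul (ite_abs (NNIdx.out (nblk idx) = idx)) f5 (abs_nonneg _) (by norm_num)
    have g2 := mul_le_mul (hw (NNIdx.out (nblk idx))) f3 (abs_nonneg _) hδ0
    have g3 := mul_le_mul ((le_max_right _ _).trans (hout (nblk idx))) f6 (abs_nonneg _)
      (by linarith)
    obtain ⟨T, hT⟩ : ∃ T, T = B ^ (L - 1) * α := ⟨_, rfl⟩
    have hT1 : 1 ≤ T := hT ▸ one_le_mul_of_one_le_of_one_le (one_le_pow₀ hB1) hα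
    rw [← hT] at g1 g2 g3
    have hTT : T ^ 2 ≤ B ^ (2 * L) * α ^ 2 := by
      rw [hT, mul_pow, ← pow_mul]
      exact mul_le_mul_of_nonneg_right (pow_le_pow_right₀ hB1 (by omega)) (by positivity)
    have q3 : T ^ 2 * γ ≤ B ^ (2 * L) * α ^ 2 * γ := mul_le_mul_of_nonneg_right hTT (by linarith)
    have q1 : T ≤ B ^ (2 * L) * α ^ 2 * γ := by
      refine le_trans ?_ q3
      have : T ≤ T ^ 2 := by nlinarith
      nlinarith
    have hCδ : 0 ≤ C * δ := by positivity
    have p1 := mul_le_mul_of_nonneg_left q1 hCδ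
    have p3 := mul_le_mul_of_nonneg_left q3 hCδ
    have p4 : 0 ≤ B ^ (2 * L) * α ^ 2 * γ * δ := by positivity
    linarith
  have hsup : ∀ idx, (⨆ s : Fin n,
      (dNet σ K L r d w1 idx (X s) - dNet σ K L r d w2 idx (X s)) ^ 2) ≤
      ((3 * C + 1) * (B ^ (2 * L) * α ^ 2 * γ * ‖w1 - w2‖)) ^ 2 := fun idx =>
    Real.iSup_le (fun s => by
      rw [← sq_abs]
      exact pow_le_pow_left₀ (abs_nonneg _) (hcoord idx s) 2) (by positivity)
  refine (Finset.sum_le_sum fun idx _ => hsup idx).trans ?_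
  rw [Finset.sum_const, nsmul_eq_mul, Finset.card_univ]
  have hcard : (Fintype.card (NNIdx K L r d) : ℝ) ≤ K * N := by
    have := card_idx K L r d
    rw [← hN] at this
    exact_mod_cast this
  refine (mul_le_mul_of_nonneg_right hcard (by positivity)).trans (le_of_eq ?_)
  have : B ^ (4 * L) = (B ^ (2 * L)) ^ 2 := by rw [← pow_mul]; congr 1; ring
  rw [this]
  ring
end
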